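/- arXiv:2501.15978 — 2 statements merged into one kernel-verified Lean document; each statement's English description precedes it below -/
import Mathlib

section
/- Let τ be a square-tiled surface with profile (μ, k), let {i,j} be {R,G} or {G,B}, let c be an {i,j}-component of τ, and let τ' = Shear_{c,i,j}(τ). Then τ' is again a square-tiled surface (its three permutations are involutions generating a transitive subgroup) and τ' has the same profile (μ, k) as τ: the products τ_R·τ_G·τ_B and τ'_R·τ'_G·τ'_B have the same cycle type, and the total number of fixed points of the three involutions of τ' equals k. -/
/-! Common definitions: square-tiled surfaces as triples of involutions,
cylinder shears, profiles, etc. -/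

inductive Color : Type
  | R | G | B
  deriving DecidableEq

/-- A candidate square-tiled surface on `Fin n`: a triple of permutations
indexed by the three colours. -/
abbrev Surf (n : ℕ) := Color → Equiv.Perm (Fin n)

/-- `f` is a square-tiled surface on `{1,…,n}` (`n ≥ 1`): the three permutations are
involutions and the subgroup they generate acts transitively. -/
def IsSTS (n : ℕ) (f : Surf n) : Prop :=
  1 ≤ n ∧ (∀ X, f X * f X = 1) ∧
    ∀ x y : Fin n,
      ∃ p ∈ Subgroup.closure ({f Color.R, f Color.G, f Color.B} : Set (Equiv.Perm (Fin n))),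
        p x = y

/-- Number of fixed points of a permutation of `Fin n`. -/
def fixedCount {n : ℕ} (π : Equiv.Perm (Fin n)) : ℕ :=
  (Finset.univ.filter fun x => π x = x).card

/-- Number of cycles of length `i` of `π`, fixed points counted as cycles of length 1. -/
def cycleCount {n : ℕ} (π : Equiv.Perm (Fin n)) (i : ℕ) : ℕ :=
  if i = 1 then fixedCount π else Multiset.count i π.cycleType

/-- The product `τ_R · τ_G · τ_B`. -/
def prodRGB {n : ℕ} (f : Surf n) : Equiv.Perm (Fin n) :=
  f Color.R * f Color.G * f Color.B

/-- Total number of fixed points of the three permutations. -/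
def totalFixed {n : ℕ} (f : Surf n) : ℕ :=
  fixedCount (f Color.R) + fixedCount (f Color.G) + fixedCount (f Color.B)

/-- `f` has profile `(μ, k)`: `μ i` is the number of cycles of length `i` of
`τ_R·τ_G·τ_B` (for `i ≥ 1`), and `k` is the total number of fixed points of the
three involutions. -/
def HasProfile {n : ℕ} (f : Surf n) (μ : ℕ → ℕ) (k : ℕ) : Prop :=
  (∀ i, 1 ≤ i → cycleCount (prodRGB f) i = μ i) ∧ totalFixed f = k

open Classical in
/-- The permutation acting as `σ` on the (`σ`-invariant) set `c` and as the identity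
outside of `c`. (Junk value `1` if `c` is not `σ`-invariant.) -/
noncomputable def restrictPerm {α : Type*} (σ : Equiv.Perm α) (c : Set α) : Equiv.Perm α :=
  if h : ∀ x, σ x ∈ c ↔ x ∈ c then
    { toFun := fun x => if x ∈ c then σ x else x
      invFun := fun x => if x ∈ c then σ.symm x else x
      left_inv := fun x => by
        by_cases hx : x ∈ c
        · simp [hx, (h x).mpr hx]
        · simp [hx]
      right_inv := fun x => by
        by_cases hx : x ∈ c
        · have h1 : σ.symm x ∈ c := (h (σ.symm x)).mp (by simpa using hx)
          simp [hx, h1]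
        · simp [hx] }
  else 1

/-- `c` is an `{i,j}`-component of `f`: an orbit of the subgroup generated by
`f i` and `f j`. -/
def IsComponent (n : ℕ) (f : Surf n) (i j : Color) (c : Set (Fin n)) : Prop :=
  ∃ x : Fin n,
    c = MulAction.orbit ↥(Subgroup.closure ({f i, f j} : Set (Equiv.Perm (Fin n)))) x

/-- The cylinder shear `Shear_{c,i,j}`: replace `f i` by `f i · c_i · c_j` and
`f j` by `f j · c_i · c_j`, keeping the third permutation unchanged. -/
noncomputable def shear {n : ℕ} (f : Surf n) (i j : Color) (c : Set (Fin n)) : Surf n :=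
  fun X =>
    if X = i ∨ X = j then f X * restrictPerm (f i) c * restrictPerm (f j) c else f X

/-- `m`-th power of the cylinder shear `Shear_{c,i,j}`. -/
noncomputable def shearPow {n : ℕ} (f : Surf n) (i j : Color) (c : Set (Fin n)) : ℕ → Surf n
  | 0 => f
  | m + 1 => shear (shearPow f i j c m) i j c

/-- The unordered pair `{i,j}` is `{R,G}` or `{G,B}`. -/
def GoodPair (i j : Color) : Prop :=
  ({i, j} : Set Color) = {Color.R, Color.G} ∨ ({i, j} : Set Color) = {Color.G, Color.B}

/-- `A` (together with its complement) witnesses that `f` is Abelian. -/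
def IsAbelianWitness (n : ℕ) (f : Surf n) (A : Set (Fin n)) : Prop :=
  A.Nonempty ∧ Aᶜ.Nonempty ∧ ∀ X : Color, (⇑(f X)) '' A = Aᶜ

/-- `f` is Abelian. -/
def IsAbelian (n : ℕ) (f : Surf n) : Prop :=
  ∃ A : Set (Fin n), IsAbelianWitness n f A

/-- `f` is path-like: `f G` and `f B` alone generate a transitive subgroup and have
exactly two fixed points in total. -/
def IsPathLike (n : ℕ) (f : Surf n) : Prop :=
  (∀ x y : Fin n,
      ∃ p ∈ Subgroup.closure ({f Color.G, f Color.B} : Set (Equiv.Perm (Fin n))),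
        p x = y) ∧
    fixedCount (f Color.G) + fixedCount (f Color.B) = 2

/-- `f` and `f'` are isomorphic square-tiled surfaces. -/
def Isomorphic (n : ℕ) (f f' : Surf n) : Prop :=
  ∃ σ : Equiv.Perm (Fin n), ∀ X, f' X = σ * f X * σ⁻¹

/-- One power of a cylinder shear. -/
def ShearPowStep (n : ℕ) (f f' : Surf n) : Prop :=
  ∃ (i j : Color) (c : Set (Fin n)) (m : ℕ),
    GoodPair i j ∧ IsComponent n f i j c ∧ 1 ≤ m ∧ f' = shearPow f i j c m

/-- A sequence of `L` powers of cylinder shears from `f` to `f'`. -/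
def ShearPowSeq (n : ℕ) : ℕ → Surf n → Surf n → Prop
  | 0, f, f' => f = f'
  | L + 1, f, f' => ∃ g, ShearPowStep n f g ∧ ShearPowSeq n L g f'

/-- A single vertical (i.e. `{R,G}`) cylinder shear. -/
def VertStep (n : ℕ) (f f' : Surf n) : Prop :=
  ∃ (i j : Color) (c : Set (Fin n)),
    ({i, j} : Set Color) = {Color.R, Color.G} ∧ IsComponent n f i j c ∧ f' = shear f i j c

/-- A power of a horizontal (i.e. `{G,B}`) cylinder shear. -/
def HorizPowStep (n : ℕ) (f f' : Surf n) : Prop :=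
  ∃ (i j : Color) (c : Set (Fin n)) (m : ℕ),
    ({i, j} : Set Color) = {Color.G, Color.B} ∧ IsComponent n f i j c ∧ 1 ≤ m ∧
      f' = shearPow f i j c m

/-- A sequence of `L` operations, each a single vertical shear or a power of a
horizontal shear. -/
def MixedSeq (n : ℕ) : ℕ → Surf n → Surf n → Prop
  | 0, f, f' => f = f'
  | L + 1, f, f' => ∃ g, (VertStep n f g ∨ HorizPowStep n f g) ∧ MixedSeq n L g f'

/-- Profile `([2^{μ2}, 4g-2], 0)` (as far as the partition is concerned;
`totalFixed = 0` gives `k = 0`). -/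
def ProfileA (n g μ2 : ℕ) (f : Surf n) : Prop :=
  totalFixed f = 0 ∧ cycleCount (prodRGB f) 2 = μ2 ∧
    cycleCount (prodRGB f) (4 * g - 2) = 1 ∧
    ∀ i, 1 ≤ i → i ≠ 2 → i ≠ 4 * g - 2 → cycleCount (prodRGB f) i = 0

/-- Profile `([2^{μ2}, (2g)^2], 0)`. -/
def ProfileB (n g μ2 : ℕ) (f : Surf n) : Prop :=
  totalFixed f = 0 ∧ cycleCount (prodRGB f) 2 = μ2 ∧
    cycleCount (prodRGB f) (2 * g) = 2 ∧
    ∀ i, 1 ≤ i → i ≠ 2 → i ≠ 2 * g → cycleCount (prodRGB f) i = 0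

/-- `α` is an automorphism of `f`. -/
def IsAut {n : ℕ} (f : Surf n) (α : Equiv.Perm (Fin n)) : Prop :=
  ∀ X, α * f X = f X * α

/-- `q` is (a presentation of) the quotient of `f` by the order-2 automorphism `α`:
there is a surjection `p` whose fibers are exactly the `⟨α⟩`-orbits and which
intertwines the permutations. -/
def IsQuotientBy (n m : ℕ) (f : Surf n) (α : Equiv.Perm (Fin n)) (q : Surf m) : Prop :=
  ∃ p : Fin n → Fin m, Function.Surjective p ∧
    (∀ x y : Fin n, p x = p y ↔ (y = x ∨ y = α x)) ∧
    ∀ X x, p (f X x) = q X (p x)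

/-- `4g - 4` where `g` is the genus of `f`, i.e. `Σ_i μ_i (i-2) - k`. -/
noncomputable def genusFour {n : ℕ} (f : Surf n) : ℤ :=
  (∑ i ∈ Finset.Icc 1 n, (cycleCount (prodRGB f) i : ℤ) * ((i : ℤ) - 2)) - (totalFixed f : ℤ)

/-- `α` is a hyperelliptic involution of `f`: an order-2 automorphism whose quotient
is a square-tiled surface of genus 0. -/
def IsHyperInvolution {n : ℕ} (f : Surf n) (α : Equiv.Perm (Fin n)) : Prop :=
  IsAut f α ∧ α * α = 1 ∧ α ≠ 1 ∧
    ∃ (m : ℕ) (q : Surf m), IsSTS m q ∧ IsQuotientBy n m f α q ∧ genusFour q = -4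

/-- `α` sends every point lying on a cycle of length `2g` of `τ_R·τ_G·τ_B` to a
different cycle (hence exchanges the two cycles of length `2g`). -/
def ExchangesTwoCycles {n : ℕ} (f : Surf n) (α : Equiv.Perm (Fin n)) (g : ℕ) : Prop :=
  ∀ x : Fin n, ((prodRGB f).cycleOf x).support.card = 2 * g →
    ¬ (prodRGB f).SameCycle x (α x)

/-- Membership in `ST^hyp_Ab([2^{μ2}, 4g-2])`. -/
def InSTHypA (n g μ2 : ℕ) (f : Surf n) : Prop :=
  IsSTS n f ∧ IsAbelian n f ∧ ProfileA n g μ2 f ∧ ∃ α, IsHyperInvolution f α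

/-- Membership in `ST^hyp_Ab([2^{μ2}, (2g)^2])`. -/
def InSTHypB (n g μ2 : ℕ) (f : Surf n) : Prop :=
  IsSTS n f ∧ IsAbelian n f ∧ ProfileB n g μ2 f ∧
    ∃ α, IsHyperInvolution f α ∧ ExchangesTwoCycles f α g

theorem restrictPerm_apply {α : Type*} {σ : Equiv.Perm α} {c : Set α}
    (h : ∀ x, σ x ∈ c ↔ x ∈ c) [DecidablePred (· ∈ c)] (x : α) :
    restrictPerm σ c x = if x ∈ c then σ x else x := by
  simp only [restrictPerm, h, implies_true, dif_pos, Equiv.coe_fn_mk]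
  congr

theorem IsComponent.apply_mem_iff {n : ℕ} {f : Surf n} {i j : Color} {c : Set (Fin n)}
    (hc : IsComponent n f i j c) {X : Color} (hX : X = i ∨ X = j) (x : Fin n) :
    f X x ∈ c ↔ x ∈ c := by
  obtain ⟨y, rfl⟩ := hc
  have hmem : f X ∈ Subgroup.closure ({f i, f j} : Set (Equiv.Perm (Fin n))) :=
    Subgroup.subset_closure (by rcases hX with rfl | rfl <;> simp)
  let g : Subgroup.closure ({f i, f j} : Set (Equiv.Perm (Fin n))) := ⟨f X, hmem⟩
  change g • x ∈ MulAction.orbit _ y ↔ _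
  rw [← MulAction.orbit_eq_iff, MulAction.orbit_smul, MulAction.orbit_eq_iff]

theorem shear_of_ne {n : ℕ} (f : Surf n) {i j X : Color} (c : Set (Fin n))
    (hi : X ≠ i) (hj : X ≠ j) : shear f i j c X = f X := by
  simp [shear, hi, hj]

section

variable {n : ℕ} {f : Surf n} {i j : Color} {c : Set (Fin n)}

open Classical in
theorem shear_left_apply (hf : ∀ X, f X * f X = 1) (hc : IsComponent n f i j c) (x : Fin n) :
    shear f i j c i x = if x ∈ c then f j x else f i x := by
  have hi := hc.apply_mem_iff (.inl rfl)
  have hj := hc.apply_mem_iff (.inr rfl)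
  have hsq : ∀ X y, f X (f X y) = y := fun X => DFunLike.congr_fun (hf X)
  by_cases hx : x ∈ c <;> simp [shear, restrictPerm_apply hi, restrictPerm_apply hj, hx, hj, hsq]

open Classical in
theorem shear_right_apply (hc : IsComponent n f i j c) (x : Fin n) :
    shear f i j c j x = if x ∈ c then f j (f i (f j x)) else f j x := by
  have hi := hc.apply_mem_iff (.inl rfl)
  have hj := hc.apply_mem_iff (.inr rfl)
  by_cases hx : x ∈ c <;> simp [shear, restrictPerm_apply hi, restrictPerm_apply hj, hx, hj]

theorem shear_mul_self (hf : ∀ X, f X * f X = 1) (hc : IsComponent n f i j c) (X : Color) :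
    shear f i j c X * shear f i j c X = 1 := by
  have hi := hc.apply_mem_iff (.inl rfl)
  have hj := hc.apply_mem_iff (.inr rfl)
  have hsq : ∀ X y, f X (f X y) = y := fun X => DFunLike.congr_fun (hf X)
  by_cases hXi : X = i
  · subst hXi
    ext x
    by_cases hx : x ∈ c <;> simp [shear_left_apply hf hc, hx, hi, hj, hsq]
  by_cases hXj : X = j
  · subst hXj
    ext x
    by_cases hx : x ∈ c <;> simp [shear_right_apply hc, hx, hi, hj, hsq]
  · rw [shear_of_ne f c hXi hXj, hf]

theorem shear_left_mul_right (hf : ∀ X, f X * f X = 1) (hc : IsComponent n f i j c) :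
    shear f i j c i * shear f i j c j = f i * f j := by
  have hi := hc.apply_mem_iff (.inl rfl)
  have hj := hc.apply_mem_iff (.inr rfl)
  have hsq : ∀ X y, f X (f X y) = y := fun X => DFunLike.congr_fun (hf X)
  ext x
  by_cases hx : x ∈ c <;>
    simp [shear_left_apply hf hc, shear_right_apply hc, hx, hi, hj, hsq]

theorem shear_right_mul_left (hf : ∀ X, f X * f X = 1) (hc : IsComponent n f i j c) :
    shear f i j c j * shear f i j c i = f j * f i := by
  have hi := hc.apply_mem_iff (.inl rfl)
  have hj := hc.apply_mem_iff (.inr rfl)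
  have hsq : ∀ X y, f X (f X y) = y := fun X => DFunLike.congr_fun (hf X)
  ext x
  by_cases hx : x ∈ c <;>
    simp [shear_left_apply hf hc, shear_right_apply hc, hx, hi, hj, hsq]

theorem fixedCount_shear_add (hf : ∀ X, f X * f X = 1) (hc : IsComponent n f i j c) :
    fixedCount (shear f i j c i) + fixedCount (shear f i j c j) =
      fixedCount (f i) + fixedCount (f j) := by
  classical
  have hj := hc.apply_mem_iff (.inr rfl)
  have hsq : ∀ X y, f X (f X y) = y := fun X => DFunLike.congr_fun (hf X)
  simp only [fixedCount, Finset.card_filter]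
  rw [← Equiv.sum_comp (restrictPerm (f j) c)
      (fun x => if shear f i j c j x = x then 1 else 0),
    ← Finset.sum_add_distrib, ← Finset.sum_add_distrib]
  refine Finset.sum_congr rfl fun x _ => ?_
  by_cases hx : x ∈ c
  · simp [shear_left_apply hf hc, shear_right_apply hc, restrictPerm_apply hj, hx, hj, hsq,
      add_comm]
  · simp [shear_left_apply hf hc, shear_right_apply hc, restrictPerm_apply hj, hx]

/-- A subgroup that contains the sheared permutations has orbits stable under the original ones. -/
theorem apply_mem_orbit_of_shear_mem (hf : ∀ X, f X * f X = 1) (hc : IsComponent n f i j c)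
    {H : Subgroup (Equiv.Perm (Fin n))} (hH : ∀ X, shear f i j c X ∈ H) (X : Color) (x : Fin n) :
    ∃ p ∈ H, p x = f X x := by
  have hi := hc.apply_mem_iff (.inl rfl)
  have hj := hc.apply_mem_iff (.inr rfl)
  have hsq : ∀ X y, f X (f X y) = y := fun X => DFunLike.congr_fun (hf X)
  by_cases hXi : X = i
  · subst hXi
    by_cases hx : x ∈ c
    · refine ⟨_, H.mul_mem (hH X) (H.mul_mem (hH j) (hH X)), ?_⟩
      simp [shear_left_apply hf hc, shear_right_apply hc, hx, hi, hj, hsq]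
    · exact ⟨_, hH X, by simp [shear_left_apply hf hc, hx]⟩
  by_cases hXj : X = j
  · subst hXj
    by_cases hx : x ∈ c
    · exact ⟨_, hH i, by simp [shear_left_apply hf hc, hx]⟩
    · exact ⟨_, hH X, by simp [shear_right_apply hc, hx]⟩
  · exact ⟨_, hH X, by rw [shear_of_ne f c hXi hXj]⟩

end

theorem exists_mem_apply_eq_of_mem_closure {α : Type*} {S : Set (Equiv.Perm α)}
    {H : Subgroup (Equiv.Perm α)} (h : ∀ s ∈ S, ∀ x, ∃ p ∈ H, p x = s x)
    {g : Equiv.Perm α} (hg : g ∈ Subgroup.closure S) (x : α) : ∃ p ∈ H, p x = g x := by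
  induction hg using Subgroup.closure_induction generalizing x with
  | mem s hs => exact h s hs x
  | one => exact ⟨1, H.one_mem, rfl⟩
  | mul g₁ g₂ _ _ h₁ h₂ =>
    obtain ⟨p₂, hp₂, e₂⟩ := h₂ x
    obtain ⟨p₁, hp₁, e₁⟩ := h₁ (g₂ x)
    exact ⟨p₁ * p₂, H.mul_mem hp₁ hp₂, by simp [e₁, e₂]⟩
  | inv g _ ih =>
    obtain ⟨p, hp, e⟩ := ih (g⁻¹ x)
    refine ⟨p⁻¹, H.inv_mem hp, ?_⟩
    rw [Equiv.Perm.inv_eq_iff_eq, e]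
    exact (g.apply_symm_apply x).symm

theorem GoodPair.cases {i j : Color} (h : GoodPair i j) :
    (i = .R ∧ j = .G ∨ i = .G ∧ j = .R) ∨ (i = .G ∧ j = .B ∨ i = .B ∧ j = .G) := by
  simpa only [GoodPair, Set.pair_eq_pair_iff] using h

/-- A cylinder shear yields again a square-tiled surface with the same
profile. -/
theorem stmt2 (n : ℕ) (τ : Surf n) (hτ : IsSTS n τ) (μ : ℕ → ℕ) (k : ℕ)
    (hprof : HasProfile τ μ k) (i j : Color) (hij : GoodPair i j)
    (c : Set (Fin n)) (hc : IsComponent n τ i j c) :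
    IsSTS n (shear τ i j c) ∧ HasProfile (shear τ i j c) μ k := by
  obtain ⟨hn, hf, htrans⟩ := hτ
  refine ⟨⟨hn, shear_mul_self hf hc, fun x y => ?_⟩, ?_⟩
  · obtain ⟨g, hg, rfl⟩ := htrans x y
    refine exists_mem_apply_eq_of_mem_closure ?_ hg x
    have hmem : ∀ X, shear τ i j c X ∈ Subgroup.closure ({shear τ i j c .R, shear τ i j c .G,
        shear τ i j c .B} : Set (Equiv.Perm (Fin n))) := fun X =>
      Subgroup.subset_closure (by cases X <;> simp)
    rintro s (rfl | rfl | rfl)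
    all_goals exact apply_mem_orbit_of_shear_mem hf hc hmem _
  · have hlr := shear_left_mul_right hf hc
    have hrl := shear_right_mul_left hf hc
    have hfix := fixedCount_shear_add hf hc
    have hother : ∀ X, X ≠ i → X ≠ j → shear τ i j c X = τ X := fun X => shear_of_ne τ c
    have hprod : prodRGB (shear τ i j c) = prodRGB τ := by
      unfold prodRGB
      rcases hij.cases with (⟨rfl, rfl⟩ | ⟨rfl, rfl⟩) | (⟨rfl, rfl⟩ | ⟨rfl, rfl⟩)
      · rw [hlr, hother .B (by decide) (by decide)]
      · rw [hrl, hother .B (by decide) (by decide)]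
      · rw [mul_assoc, hlr, hother .R (by decide) (by decide), mul_assoc]
      · rw [mul_assoc, hrl, hother .R (by decide) (by decide), mul_assoc]
    have htotal : totalFixed (shear τ i j c) = totalFixed τ := by
      unfold totalFixed
      rcases hij.cases with (⟨rfl, rfl⟩ | ⟨rfl, rfl⟩) | (⟨rfl, rfl⟩ | ⟨rfl, rfl⟩)
      · rw [hother .B (by decide) (by decide)]; omega
      · rw [hother .B (by decide) (by decide)]; omega
      · rw [hother .R (by decide) (by decide)]; omega
      · rw [hother .R (by decide) (by decide)]; omega
    unfold HasProfile
    rwa [hprod, htotal]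
end

section
/- Let τ be a square-tiled surface, let {i,j} be {R,G} or {G,B}, let c be an {i,j}-component of τ, and let τ' = Shear_{c,i,j}(τ). Then the number of fixed points of τ'_R and the number of fixed points of τ_R differ by at most 2. -/
theorem restrictPerm_apply_of_mem {α : Type*} {σ : Equiv.Perm α} {c : Set α}
    (h : ∀ x, σ x ∈ c ↔ x ∈ c) {x : α} (hx : x ∈ c) : restrictPerm σ c x = σ x := by
  simp [restrictPerm, h, hx]

theorem restrictPerm_apply_of_notMem {α : Type*} {σ : Equiv.Perm α} {c : Set α}
    (h : ∀ x, σ x ∈ c ↔ x ∈ c) {x : α} (hx : x ∉ c) : restrictPerm σ c x = x := by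
  simp [restrictPerm, h, hx]

theorem mul_zpow_eq_zpow_neg_mul {G : Type*} [Group G] {a b : G}
    (ha : a * a = 1) (hb : b * b = 1) (k : ℤ) : a * (b * a) ^ k = (b * a) ^ (-k) * a := by
  have h : SemiconjBy a (b * a) (b * a)⁻¹ := by
    simp [SemiconjBy, mul_assoc, inv_eq_of_mul_eq_one_left ha, inv_eq_of_mul_eq_one_left hb]
  have := h.zpow_right k
  rwa [inv_zpow'] at this

/-- The orbit of a fixed point of the involution `a` under the group generated by the involutions
`a` and `b` consists of the iterates of the point under `b * a`. -/
theorem exists_zpow_apply_eq_of_mem_closure_pair {α : Type*} {a b : Equiv.Perm α}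
    (ha : a * a = 1) (hb : b * b = 1) {x : α} (hx : a x = x)
    {g : Equiv.Perm α} (hg : g ∈ Subgroup.closure {a, b}) :
    ∃ k : ℤ, ((b * a) ^ k) x = g x := by
  have ha' : a⁻¹ = a := inv_eq_of_mul_eq_one_left ha
  have hb' : b⁻¹ = b := inv_eq_of_mul_eq_one_left hb
  have step_a (k : ℤ) : ((b * a) ^ (-k)) x = a (((b * a) ^ k) x) := by
    rw [← Equiv.Perm.mul_apply a, mul_zpow_eq_zpow_neg_mul ha hb,
      Equiv.Perm.mul_apply, hx]
  have step_b (k : ℤ) : ((b * a) ^ (1 - k)) x = b (((b * a) ^ k) x) := by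
    rw [sub_eq_add_neg, zpow_add, zpow_one, Equiv.Perm.mul_apply, step_a,
      ← Equiv.Perm.mul_apply (b * a), mul_assoc, ha, mul_one]
  induction hg using Subgroup.closure_induction_left with
  | one => exact ⟨0, rfl⟩
  | mul_left y hy g _ ih =>
    obtain ⟨k, hk⟩ := ih
    rw [Equiv.Perm.mul_apply, ← hk]
    rcases hy with rfl | rfl
    · exact ⟨_, step_a k⟩
    · exact ⟨_, step_b k⟩
  | inv_mul_cancel y hy g _ ih =>
    obtain ⟨k, hk⟩ := ih
    rw [Equiv.Perm.mul_apply, ← hk]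
    rcases hy with rfl | rfl
    · exact ⟨_, by rw [ha']; exact step_a k⟩
    · exact ⟨_, by rw [hb']; exact step_b k⟩

theorem Int.dvd_sub_of_dvd_two_mul {p k l : ℤ} (hk : p ∣ 2 * k) (hl : p ∣ 2 * l)
    (hk' : ¬ p ∣ k) (hl' : ¬ p ∣ l) : p ∣ k - l := by
  obtain ⟨u, hu⟩ := hk
  obtain ⟨v, hv⟩ := hl
  obtain ⟨s, rfl | rfl⟩ := Int.even_or_odd' u
  · exact absurd ⟨s, by linarith⟩ hk'
  obtain ⟨t, rfl | rfl⟩ := Int.even_or_odd' v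
  · exact absurd ⟨t, by linarith⟩ hl'
  exact ⟨s - t, by linarith⟩

/-- In an orbit of the group generated by two involutions, two fixed points of the first one that
differ from a third fixed point coincide. -/
theorem eq_of_fixed_of_mem_closure_pair {α : Type*} {a b : Equiv.Perm α}
    (ha : a * a = 1) (hb : b * b = 1) {x y z : α} (hx : a x = x) (hy : a y = y) (hz : a z = z)
    (hxy : ∃ g ∈ Subgroup.closure {a, b}, g x = y)
    (hxz : ∃ g ∈ Subgroup.closure {a, b}, g x = z) (hy' : x ≠ y) (hz' : x ≠ z) : y = z := by
  have dvd_iff (k : ℤ) : ((b * a) ^ k) x = x ↔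
      (Function.minimalPeriod ((b * a) • ·) x : ℤ) ∣ k :=
    MulAction.zpow_smul_eq_iff_minimalPeriod_dvd (a := b * a) (b := x) (n := k)
  have two_mul_fixed (k : ℤ) (h : a (((b * a) ^ k) x) = ((b * a) ^ k) x) :
      ((b * a) ^ (2 * k)) x = x := by
    rw [← Equiv.Perm.mul_apply a, mul_zpow_eq_zpow_neg_mul ha hb,
      Equiv.Perm.mul_apply, hx] at h
    rw [two_mul, zpow_add, Equiv.Perm.mul_apply, ← h, ← Equiv.Perm.mul_apply, ← zpow_add]
    simp
  obtain ⟨g, hg, rfl⟩ := hxy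
  obtain ⟨g', hg', rfl⟩ := hxz
  obtain ⟨k, hk⟩ := exists_zpow_apply_eq_of_mem_closure_pair ha hb hx hg
  obtain ⟨l, hl⟩ := exists_zpow_apply_eq_of_mem_closure_pair ha hb hx hg'
  rw [← hk] at hy hy' ⊢
  rw [← hl] at hz hz' ⊢
  have key := (dvd_iff _).2 (Int.dvd_sub_of_dvd_two_mul
    ((dvd_iff _).1 (two_mul_fixed k hy)) ((dvd_iff _).1 (two_mul_fixed l hz))
    (fun h => hy' ((dvd_iff _).2 h).symm) (fun h => hz' ((dvd_iff _).2 h).symm))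
  calc ((b * a) ^ k) x = ((b * a) ^ l) (((b * a) ^ (k - l)) x) := by
        rw [← Equiv.Perm.mul_apply, ← zpow_add]; simp
    _ = ((b * a) ^ l) x := by rw [key]

theorem smul_mem_orbit_iff {G α : Type*} [Group G] [MulAction G α] (g : G) {x y : α} :
    g • x ∈ MulAction.orbit G y ↔ x ∈ MulAction.orbit G y := by
  rw [← MulAction.orbit_eq_iff, ← MulAction.orbit_eq_iff, MulAction.orbit_smul]

open Classical in
/-- An involution has at most two fixed points in an orbit of the group it generates together with
another involution. -/
theorem card_fixed_orbit_closure_pair_le_two {α : Type*} [Fintype α] {a b : Equiv.Perm α}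
    (ha : a * a = 1) (hb : b * b = 1) (w : α) :
    (Finset.univ.filter fun x =>
      x ∈ MulAction.orbit (Subgroup.closure {a, b}) w ∧ a x = x).card ≤ 2 := by
  by_contra! h
  obtain ⟨x, y, z, hx, hy, hz, hxy, hxz, hyz⟩ := Finset.two_lt_card_iff.1 h
  simp only [Finset.mem_filter, Finset.mem_univ, true_and] at hx hy hz
  have conn {u : α} (hu : u ∈ MulAction.orbit (Subgroup.closure {a, b}) w) :
      ∃ g ∈ Subgroup.closure {a, b}, g x = u := by
    rw [← MulAction.orbit_eq_iff.2 hx.1] at hu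
    obtain ⟨g, hg⟩ := hu
    exact ⟨g, g.2, hg⟩
  exact hyz (eq_of_fixed_of_mem_closure_pair ha hb hx.2 hy.2 hz.2 (conn hy.1) (conn hz.1) hxy hxz)

open Classical in
theorem abs_fixedCount_sub_le_two {n : ℕ} {π σ : Equiv.Perm (Fin n)} {c : Set (Fin n)}
    (h : ∀ x ∉ c, π x = σ x)
    (hπ : (Finset.univ.filter fun x => x ∈ c ∧ π x = x).card ≤ 2)
    (hσ : (Finset.univ.filter fun x => x ∈ c ∧ σ x = x).card ≤ 2) :
    |(fixedCount π : ℤ) - (fixedCount σ : ℤ)| ≤ 2 := by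
  have split (ρ : Equiv.Perm (Fin n)) : fixedCount ρ =
      (Finset.univ.filter fun x => x ∈ c ∧ ρ x = x).card +
        (Finset.univ.filter fun x => x ∉ c ∧ ρ x = x).card := by
    rw [fixedCount, ← Finset.card_filter_add_card_filter_not (· ∈ c), Finset.filter_filter,
      Finset.filter_filter]
    simp only [and_comm]
  have out : (Finset.univ.filter fun x => x ∉ c ∧ π x = x) =
      Finset.univ.filter fun x => x ∉ c ∧ σ x = x :=
    Finset.filter_congr fun x _ => and_congr_right fun hx => by rw [h x hx]
  rw [split π, split σ, out, abs_le]
  omega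

/-- A cylinder shear changes the number of fixed points of `τ_R` by at
most 2. -/
theorem stmt8 (n : ℕ) (τ : Surf n) (hτ : IsSTS n τ) (i j : Color) (hij : GoodPair i j)
    (c : Set (Fin n)) (hc : IsComponent n τ i j c) :
    |(fixedCount (shear τ i j c Color.R) : ℤ) - (fixedCount (τ Color.R) : ℤ)| ≤ 2 := by
  classical
  obtain ⟨w, rfl⟩ := hc
  have hinv := hτ.2.1
  set c := MulAction.orbit ↥(Subgroup.closure ({τ i, τ j} : Set (Equiv.Perm (Fin n)))) w with hc
  have hi (x : Fin n) : τ i x ∈ c ↔ x ∈ c :=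
    smul_mem_orbit_iff
      (⟨τ i, Subgroup.subset_closure (by simp)⟩ : Subgroup.closure {τ i, τ j})
  have hj (x : Fin n) : τ j x ∈ c ↔ x ∈ c :=
    smul_mem_orbit_iff
      (⟨τ j, Subgroup.subset_closure (by simp)⟩ : Subgroup.closure {τ i, τ j})
  have hinv_apply (X : Color) (x : Fin n) : τ X (τ X x) = x := by
    rw [← Equiv.Perm.mul_apply, hinv, Equiv.Perm.one_apply]
  have card_i : (Finset.univ.filter fun x => x ∈ c ∧ τ i x = x).card ≤ 2 := by
    convert card_fixed_orbit_closure_pair_le_two (hinv i) (hinv j) w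
  have card_j : (Finset.univ.filter fun x => x ∈ c ∧ τ j x = x).card ≤ 2 := by
    rw [hc, Set.pair_comm]
    convert card_fixed_orbit_closure_pair_le_two (hinv j) (hinv i) w
  have shear_apply {x : Fin n} (hR : Color.R = i ∨ Color.R = j) (hx : x ∈ c) :
      shear τ i j c Color.R x = τ Color.R (τ i (τ j x)) := by
    simp only [shear, if_pos hR, Equiv.Perm.mul_apply]
    rw [restrictPerm_apply_of_mem hj hx, restrictPerm_apply_of_mem hi ((hj x).2 hx)]
  by_cases hR : Color.R = i ∨ Color.R = j
  · have out : ∀ x ∉ c, shear τ i j c Color.R x = τ Color.R x := fun x hx => by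
      simp only [shear, if_pos hR, Equiv.Perm.mul_apply]
      rw [restrictPerm_apply_of_notMem hj hx, restrictPerm_apply_of_notMem hi hx]
    rcases id hR with h | h
    · refine abs_fixedCount_sub_le_two out (le_trans (Finset.card_le_card ?_) card_j) (h ▸ card_i)
      intro x
      simp only [Finset.mem_filter, Finset.mem_univ, true_and]
      rintro ⟨hx, hfix⟩
      rw [shear_apply hR hx, h, hinv_apply] at hfix
      exact ⟨hx, hfix⟩
    · refine abs_fixedCount_sub_le_two out (le_trans (Finset.card_le_card_of_injOn (τ j) ?_
        (τ j).injective.injOn) card_i) (h ▸ card_j)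
      intro x
      simp only [Finset.coe_filter, Set.mem_ofPred_eq, Finset.mem_univ, true_and]
      rintro ⟨hx, hfix⟩
      rw [shear_apply hR hx, h] at hfix
      exact ⟨(hj x).2 hx, by rw [← hinv_apply j (τ i (τ j x)), hfix]⟩
  · simp [shear, if_neg hR]
end
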